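/- For every closed pure λ-calculus term e, the standard reduction sequence of e in the revised call-by-need calculus reaches an answer if and only if the λ_LR rewriting sequence of e (viewing e as a λ_LR program using only variables, abstractions, and applications) reaches a value; i.e., the λ_LR rewriting semantics and the standard reduction sequences of the revised call-by-need calculus bisimulate on the pure λ-calculus fragment. -/

import Mathlib

namespace NeedCalc

/-- Terms of the pure λ-calculus, in de Bruijn representation (so that
    α-equivalent terms are syntactically equal). -/
inductive Tm : Type
  | bvar : Nat → Tm
  | lam  : Tm → Tm
  | app  : Tm → Tm → Tm
deriving DecidableEq

namespace Tm

/-- Shift the free de Bruijn indices ≥ k up by n. -/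
def lift (n : Nat) : Nat → Tm → Tm
  | k, .bvar i => if i < k then .bvar i else .bvar (i + n)
  | k, .lam b => .lam (lift n (k+1) b)
  | k, .app f a => .app (lift n k f) (lift n k a)

/-- Capture-avoiding substitution of `s` for the de Bruijn index `k`. -/
def subst : Tm → Nat → Tm → Tm
  | .bvar i, k, s => if i = k then lift k 0 s else if k < i then .bvar (i-1) else .bvar i
  | .lam b, k, s => .lam (subst b (k+1) s)
  | .app f a, k, s => .app (subst f k s) (subst a k s)

end Tm

/-- Values V ::= λx.e. -/
def IsValT (t : Tm) : Prop := ∃ b, t = Tm.lam b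

/-- Answers A ::= V | ((λx.A) e). -/
inductive IsAnswer : Tm → Prop
  | lam (b : Tm) : IsAnswer (.lam b)
  | app {a : Tm} (e : Tm) : IsAnswer a → IsAnswer (.app (.lam a) e)

/-- Evaluation contexts
    E ::= □ | (E e) | ((λx.E₁[x]) E) | ((λx.E) e).
    In `appNeed B E` the context `B` is the body context whose hole is
    filled with the variable bound by the λ (de Bruijn index `B.depth`),
    and the overall hole is in the argument context `E`. -/
inductive ECtx : Type
  | hole    : ECtx
  | appL    : ECtx → Tm → ECtx
  | appNeed : ECtx → ECtx → ECtx
  | appBody : ECtx → Tm → ECtx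

/-- Number of λ-binders crossed between the root of the context and its hole. -/
def ECtx.depth : ECtx → Nat
  | .hole => 0
  | .appL E _ => E.depth
  | .appNeed _ E => E.depth
  | .appBody E _ => E.depth + 1

/-- Plugging a term into the hole of an evaluation context. -/
def ECtx.plug : ECtx → Tm → Tm
  | .hole, t => t
  | .appL E e, t => .app (E.plug t) e
  | .appNeed B E, t => .app (.lam (B.plug (.bvar B.depth))) (E.plug t)
  | .appBody E e, t => .app (.lam (E.plug t)) e

/-- The notions of reduction of the revised call-by-need λ-calculus:
    β_need, lift, and assoc. -/
inductive Redn : Tm → Tm → Prop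
  | beta (E : ECtx) (b : Tm) :
      Redn (.app (.lam (E.plug (.bvar E.depth))) (.lam b))
           (Tm.subst (E.plug (.bvar E.depth)) 0 (.lam b))
  | liftR {a : Tm} (e e' : Tm) : IsAnswer a →
      Redn (.app (.app (.lam a) e) e')
           (.app (.lam (.app a (Tm.lift 1 0 e'))) e)
  | assoc (E : ECtx) {a : Tm} (e : Tm) : IsAnswer a →
      Redn (.app (.lam (E.plug (.bvar E.depth))) (.app (.lam a) e))
           (.app (.lam (.app (Tm.lift 1 0 (.lam (E.plug (.bvar E.depth)))) a)) e)

/-- One-step reduction: the compatible (contextual) closure of the notions of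
    reduction. -/
inductive Red1 : Tm → Tm → Prop
  | base {t t' : Tm} : Redn t t' → Red1 t t'
  | lam {b b' : Tm} : Red1 b b' → Red1 (.lam b) (.lam b')
  | appL {f f' : Tm} (a : Tm) : Red1 f f' → Red1 (.app f a) (.app f' a)
  | appR (f : Tm) {a a' : Tm} : Red1 a a' → Red1 (.app f a) (.app f a')

/-- Reflexive-transitive closure of one-step reduction. -/
def Reds : Tm → Tm → Prop := Relation.ReflTransGen Red1

/-- Standard reduction: contract only the redex in the hole of an evaluation
    context. -/
inductive StdStep : Tm → Tm → Prop
  | mk (E : ECtx) (r r' : Tm) : Redn r r' → StdStep (E.plug r) (E.plug r')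

end NeedCalc

namespace NeedCalc

/-- The λ-fragment of λ_LR: variables (in de Bruijn representation),
    abstractions, applications, and labeled expressions. -/
inductive LTm : Type
  | bvar : Nat → LTm
  | lam  : LTm → LTm
  | app  : LTm → LTm → LTm
  | lab  : Nat → LTm → LTm
deriving DecidableEq

namespace LTm

def lift (n : Nat) : Nat → LTm → LTm
  | k, .bvar i => if i < k then .bvar i else .bvar (i + n)
  | k, .lam b => .lam (lift n (k+1) b)
  | k, .app f a => .app (lift n k f) (lift n k a)
  | k, .lab ℓ e => .lab ℓ (lift n k e)

def subst : LTm → Nat → LTm → LTm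
  | .bvar i, k, s => if i = k then lift k 0 s else if k < i then .bvar (i-1) else .bvar i
  | .lam b, k, s => .lam (subst b (k+1) s)
  | .app f a, k, s => .app (subst f k s) (subst a k s)
  | .lab ℓ e, k, s => .lab ℓ (subst e k s)

def hasLab (ℓ : Nat) : LTm → Prop
  | .bvar _ => False
  | .lam b => hasLab ℓ b
  | .app f a => hasLab ℓ f ∨ hasLab ℓ a
  | .lab ℓ' e => ℓ = ℓ' ∨ hasLab ℓ e

/-- Parallel update: replace every subexpression immediately under an
    occurrence of the label ℓ by `new`. -/
def update (ℓ : Nat) (new : LTm) : LTm → LTm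
  | .lab ℓ' e => if ℓ' = ℓ then .lab ℓ' new else .lab ℓ' (update ℓ new e)
  | .lam b => .lam (update ℓ new b)
  | .app f a => .app (update ℓ new f) (update ℓ new a)
  | e => e

end LTm

/-- λ_LR values of the λ-fragment: abstractions and labeled values. -/
inductive LVal : LTm → Prop
  | lam (b : LTm) : LVal (.lam b)
  | lab (ℓ : Nat) {v : LTm} : LVal v → LVal (.lab ℓ v)

/-- `LWrapped e e'` : `e` is `e'` wrapped in zero or more labels. -/
inductive LWrapped : LTm → LTm → Prop
  | refl (e : LTm) : LWrapped e e
  | lab (ℓ : Nat) {e e' : LTm} : LWrapped e e' → LWrapped (.lab ℓ e) e'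

/-- λ_LR evaluation contexts of the λ-fragment: E ::= □ | (E e) | ℓ:E. -/
inductive LCtx : Type
  | hole : LCtx
  | appL : LCtx → LTm → LCtx
  | labC : Nat → LCtx → LCtx

def LCtx.plug : LCtx → LTm → LTm
  | .hole, t => t
  | .appL E e, t => .app (E.plug t) e
  | .labC ℓ E, t => .lab ℓ (E.plug t)

def LCtx.noLab : LCtx → Prop
  | .hole => True
  | .appL E _ => E.noLab
  | .labC _ _ => False

/-- Contraction: the β rule of λ_LR substitutes the argument wrapped in a
    fresh label (fresh with respect to the whole program `P`). -/
inductive LContr (P : LTm) : LTm → LTm → Prop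
  | beta {f : LTm} (b e : LTm) (ℓ : Nat) :
      LWrapped f (.lam b) → ¬ LTm.hasLab ℓ P →
      LContr P (.app f e) (LTm.subst b 0 (.lab ℓ e))

/-- One-step rewriting of λ_LR programs (λ-fragment), with parallel update
    of all expressions sharing the label nearest the redex. -/
inductive LStep : LTm → LTm → Prop
  | noLab (E : LCtx) (r r' : LTm) :
      E.noLab → LContr (E.plug r) r r' → LStep (E.plug r) (E.plug r')
  | underLab (E₁ E₂ : LCtx) (ℓ : Nat) (r r' : LTm) :
      E₂.noLab → LContr (E₁.plug (.lab ℓ (E₂.plug r))) r r' →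
      LStep (E₁.plug (.lab ℓ (E₂.plug r)))
            (LTm.update ℓ (E₂.plug r') (E₁.plug (.lab ℓ (E₂.plug r'))))

/-- Embedding of pure λ-terms into the λ-fragment of λ_LR. -/
def toL : Tm → LTm
  | .bvar i => .bvar i
  | .lam b => .lam (toL b)
  | .app f a => .app (toL f) (toL a)

/-- A term is closed under k binders. -/
def ClosedUnder : Nat → Tm → Prop
  | k, .bvar i => i < k
  | k, .lam b => ClosedUnder (k+1) b
  | k, .app f a => ClosedUnder k f ∧ ClosedUnder k a

/-! ### Parallel renaming and substitution -/

namespace Tm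

/-- Push a renaming under a binder. -/
def upRen (ρ : Nat → Nat) : Nat → Nat
  | 0 => 0
  | i + 1 => ρ i + 1

/-- Simultaneous renaming. -/
def ren : (Nat → Nat) → Tm → Tm
  | ρ, .bvar i => .bvar (ρ i)
  | ρ, .lam b => .lam (ren (upRen ρ) b)
  | ρ, .app f a => .app (ren ρ f) (ren ρ a)

/-- Push a substitution under a binder. -/
def up (σ : Nat → Tm) : Nat → Tm
  | 0 => .bvar 0
  | i + 1 => ren Nat.succ (σ i)

/-- Simultaneous substitution. -/
def inst : (Nat → Tm) → Tm → Tm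
  | σ, .bvar i => σ i
  | σ, .lam b => .lam (inst (up σ) b)
  | σ, .app f a => .app (inst σ f) (inst σ a)

/-- Extend a substitution by a term for the index `0`. -/
def scons (a : Tm) (σ : Nat → Tm) : Nat → Tm
  | 0 => a
  | i + 1 => σ i

theorem up_bvar : up .bvar = .bvar := by
  funext i; cases i <;> rfl

@[simp] theorem inst_bvar (t : Tm) : t.inst .bvar = t := by
  induction t with
  | bvar i => rfl
  | lam b ih => simp [inst, up_bvar, ih]
  | app f a ihf iha => simp [inst, ihf, iha]

theorem ren_eq_inst (t : Tm) (ρ : Nat → Nat) : t.ren ρ = t.inst (fun i => .bvar (ρ i)) := by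
  induction t generalizing ρ with
  | bvar i => rfl
  | lam b ih =>
    have h : up (fun i => .bvar (ρ i)) = fun i => .bvar (upRen ρ i) := by
      funext i; cases i <;> rfl
    simp [inst, ren, ih, h]
  | app f a ihf iha => simp [inst, ren, ihf, iha]

theorem inst_ren (t : Tm) (ρ : Nat → Nat) (σ : Nat → Tm) :
    (t.ren ρ).inst σ = t.inst (fun i => σ (ρ i)) := by
  induction t generalizing ρ σ with
  | bvar i => rfl
  | lam b ih =>
    have h : (fun i => up σ (upRen ρ i)) = up (fun i => σ (ρ i)) := by
      funext i; cases i <;> rfl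
    simp [inst, ren, ih, h]
  | app f a ihf iha => simp [inst, ren, ihf, iha]

theorem ren_ren (t : Tm) (ρ ρ' : Nat → Nat) : (t.ren ρ).ren ρ' = t.ren (fun i => ρ' (ρ i)) := by
  rw [ren_eq_inst _ ρ', inst_ren, ren_eq_inst]

theorem ren_inst (t : Tm) (σ : Nat → Tm) (ρ : Nat → Nat) :
    (t.inst σ).ren ρ = t.inst (fun i => (σ i).ren ρ) := by
  induction t generalizing ρ σ with
  | bvar i => rfl
  | lam b ih =>
    have h : (fun i => (up σ i).ren (upRen ρ)) = up (fun i => (σ i).ren ρ) := by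
      funext i
      cases i with
      | zero => rfl
      | succ i => simp [up, ren_ren, upRen]
    simp [inst, ren, ih, h]
  | app f a ihf iha => simp [inst, ren, ihf, iha]

theorem inst_inst (t : Tm) (σ τ : Nat → Tm) :
    (t.inst σ).inst τ = t.inst (fun i => (σ i).inst τ) := by
  induction t generalizing σ τ with
  | bvar i => rfl
  | lam b ih =>
    have h : (fun i => (up σ i).inst (up τ)) = up (fun i => (σ i).inst τ) := by
      funext i
      cases i with
      | zero => rfl
      | succ i => simp [up, inst_ren, ren_inst]
    simp [inst, ih, h]
  | app f a ihf iha => simp [inst, ihf, iha]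

theorem inst_up_scons (b a : Tm) (σ : Nat → Tm) :
    (b.inst (up σ)).inst (scons a .bvar) = b.inst (scons a σ) := by
  rw [inst_inst]
  congr 1
  funext i
  cases i with
  | zero => rfl
  | succ i => simp [up, inst_ren, scons]

theorem inst_scons_inst (b a : Tm) (σ : Nat → Tm) :
    (b.inst (scons a .bvar)).inst σ = b.inst (scons (a.inst σ) σ) := by
  rw [inst_inst]
  congr 1
  funext i
  cases i <;> rfl

theorem lift_eq_ren (n k : Nat) (t : Tm) :
    t.lift n k = t.ren (fun i => if i < k then i else i + n) := by
  induction t generalizing k with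
  | bvar i => simp only [lift, ren]; split <;> rfl
  | lam b ih =>
    simp only [lift, ren, ih]
    congr 2
    funext i
    cases i with
    | zero => simp [upRen]
    | succ i => simp only [upRen]; split_ifs <;> omega
  | app f a ihf iha => simp [lift, ren, ihf, iha]

theorem lift_zero_eq_ren (n : Nat) (t : Tm) : t.lift n 0 = t.ren (fun i => i + n) := by
  simp [lift_eq_ren]

theorem subst_eq_inst_ite (b : Tm) (k : Nat) (s : Tm) :
    b.subst k s =
      b.inst (fun i => if i = k then s.lift k 0 else if k < i then .bvar (i-1) else .bvar i) := by
  induction b generalizing k with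
  | bvar i => rfl
  | lam b ih =>
    simp only [subst, inst, ih]
    congr 2
    funext i
    cases i with
    | zero => simp [up]
    | succ i =>
      simp only [up, Nat.add_right_cancel_iff, Nat.add_lt_add_iff_right]
      split_ifs
      · simp [lift_zero_eq_ren, ren_ren, Nat.add_assoc]
      · simp only [ren]; congr 1; omega
      · rfl
  | app f a ihf iha => simp [subst, inst, ihf, iha]

theorem subst_zero_eq_inst (b s : Tm) : b.subst 0 s = b.inst (scons s .bvar) := by
  rw [subst_eq_inst_ite]
  congr 1
  funext i
  cases i with
  | zero => simp [scons, lift_zero_eq_ren, ren_eq_inst]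
  | succ i => simp [scons]

theorem lift_one_inst_scons (t a : Tm) (σ : Nat → Tm) :
    (t.lift 1 0).inst (scons a σ) = t.inst σ := by
  rw [lift_zero_eq_ren, inst_ren]; rfl

end Tm

/-- `Ev n t L`: weak head (call-by-name) evaluation of `t` applied to the arguments `L`
    reaches an abstraction after exactly `n` β-steps. -/
inductive Ev : Nat → Tm → List Tm → Prop
  | lam (b : Tm) : Ev 0 (.lam b) []
  | beta {n : Nat} {b a : Tm} {L : List Tm} :
      Ev n (b.inst (Tm.scons a .bvar)) L → Ev (n + 1) (.lam b) (a :: L)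
  | push {n : Nat} {f a : Tm} {L : List Tm} : Ev n f (a :: L) → Ev n (.app f a) L

theorem ev_app {n : Nat} {f a : Tm} {L : List Tm} : Ev n (.app f a) L ↔ Ev n f (a :: L) :=
  ⟨fun h => by cases h; assumption, .push⟩

theorem ev_lam_cons {n : Nat} {b a : Tm} {L : List Tm} :
    Ev n (.lam b) (a :: L) ↔ ∃ m, n = m + 1 ∧ Ev m (b.inst (Tm.scons a .bvar)) L :=
  ⟨fun h => by cases h; exact ⟨_, rfl, by assumption⟩, by rintro ⟨m, rfl, h⟩; exact .beta h⟩

theorem not_ev_bvar {n i : Nat} {L : List Tm} : ¬ Ev n (.bvar i) L := nofun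

/-! ### The evaluation preorder and its congruence property -/

/-- `Ciu c t t'`: under all substitutions and arguments, `t'` evaluates to an abstraction whenever
    `t` does; if `c` holds, in at most as many steps. -/
def Ciu (c : Prop) (t t' : Tm) : Prop :=
  ∀ (σ : Nat → Tm) (L : List Tm) (n : Nat), Ev n (t.inst σ) L →
    ∃ m, (c → m ≤ n) ∧ Ev m (t'.inst σ) L

namespace Ciu

variable {c : Prop}

theorem refl (t : Tm) : Ciu c t t := fun _ _ n h => ⟨n, fun _ => le_rfl, h⟩

theorem trans {t u v : Tm} (h₁ : Ciu c t u) (h₂ : Ciu c u v) : Ciu c t v := by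
  intro σ L n h
  obtain ⟨m, hm, h⟩ := h₁ σ L n h
  obtain ⟨k, hk, h⟩ := h₂ σ L m h
  exact ⟨k, fun hc => (hk hc).trans (hm hc), h⟩

theorem inst {t t' : Tm} (h : Ciu c t t') (σ : Nat → Tm) : Ciu c (t.inst σ) (t'.inst σ) := by
  intro τ L n
  rw [Tm.inst_inst, Tm.inst_inst]
  exact h _ L n

theorem ev {t t' : Tm} (h : Ciu c t t') {L : List Tm} {n : Nat} (he : Ev n t L) :
    ∃ m, (c → m ≤ n) ∧ Ev m t' L := by
  simpa using h .bvar L n (by simpa using he)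

end Ciu

/-- The Howe closure of `Ciu`. -/
inductive Howe (c : Prop) : Tm → Tm → Prop
  | bvar {i : Nat} {t : Tm} : Ciu c (.bvar i) t → Howe c (.bvar i) t
  | lam {b b' t : Tm} : Howe c b b' → Ciu c (.lam b') t → Howe c (.lam b) t
  | app {f f' a a' t : Tm} : Howe c f f' → Howe c a a' → Ciu c (.app f' a') t →
      Howe c (.app f a) t

namespace Howe

variable {c : Prop}

theorem refl (t : Tm) : Howe c t t := by
  induction t with
  | bvar i => exact .bvar (.refl _)
  | lam b ih => exact .lam ih (.refl _)
  | app f a ihf iha => exact .app ihf iha (.refl _)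

theorem trans_ciu {t u v : Tm} (h₁ : Howe c t u) (h₂ : Ciu c u v) : Howe c t v := by
  cases h₁ with
  | bvar h => exact .bvar (h.trans h₂)
  | lam hb h => exact .lam hb (h.trans h₂)
  | app hf ha h => exact .app hf ha (h.trans h₂)

theorem of_ciu {t u : Tm} (h : Ciu c t u) : Howe c t u := (refl t).trans_ciu h

theorem ren {t t' : Tm} (h : Howe c t t') (ρ : Nat → Nat) : Howe c (t.ren ρ) (t'.ren ρ) := by
  induction h generalizing ρ with
  | bvar h => exact of_ciu (by simpa [Tm.ren_eq_inst] using h.inst _)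
  | lam _ h ih =>
    refine .lam (ih _) ?_
    have := h.inst (fun i => .bvar (ρ i))
    rwa [← Tm.ren_eq_inst, ← Tm.ren_eq_inst] at this
  | app _ _ h ihf iha =>
    refine .app (ihf _) (iha _) ?_
    simpa [Tm.ren_eq_inst, Tm.inst] using h.inst (fun i => .bvar (ρ i))

theorem up {σ σ' : Nat → Tm} (h : ∀ i, Howe c (σ i) (σ' i)) (i : Nat) :
    Howe c (Tm.up σ i) (Tm.up σ' i) := by
  cases i with
  | zero => exact refl _
  | succ i => exact (h i).ren _

theorem inst {t t' : Tm} (h : Howe c t t') {σ σ' : Nat → Tm} (hσ : ∀ i, Howe c (σ i) (σ' i)) :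
    Howe c (t.inst σ) (t'.inst σ') := by
  induction h generalizing σ σ' with
  | bvar h => exact (hσ _).trans_ciu (h.inst σ')
  | lam _ h ih => exact .lam (ih (up hσ)) (h.inst σ')
  | app _ _ h ihf iha => exact .app (ihf hσ) (iha hσ) (h.inst σ')

theorem scons {a a' : Tm} (ha : Howe c a a') {σ σ' : Nat → Tm} (hσ : ∀ i, Howe c (σ i) (σ' i))
    (i : Nat) : Howe c (Tm.scons a σ i) (Tm.scons a' σ' i) := by
  cases i with
  | zero => exact ha
  | succ i => exact hσ i

theorem ev {n : Nat} {t : Tm} {L : List Tm} (he : Ev n t L) {t' : Tm} {L' : List Tm}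
    (ht : Howe c t t') (hL : List.Forall₂ (Howe c) L L') :
    ∃ m, (c → m ≤ n) ∧ Ev m t' L' := by
  induction he generalizing t' L' with
  | lam b =>
    cases hL
    cases ht with
    | lam _ h => exact h.ev (.lam _)
  | beta _ ih =>
    cases hL with
    | cons ha hL =>
      cases ht with
      | lam hb h =>
        obtain ⟨m, hm, he⟩ := ih (hb.inst (scons ha fun i => refl _)) hL
        obtain ⟨k, hk, he⟩ := h.ev (.beta he)
        exact ⟨k, fun hc => (hk hc).trans (Nat.succ_le_succ (hm hc)), he⟩
  | push _ ih =>
    cases ht with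
    | app hf ha h =>
      obtain ⟨m, hm, he⟩ := ih hf (.cons ha hL)
      obtain ⟨k, hk, he⟩ := h.ev (.push he)
      exact ⟨k, fun hc => (hk hc).trans (hm hc), he⟩

theorem ciu {t t' : Tm} (h : Howe c t t') : Ciu c t t' := fun _ _ _ he =>
  ev he (h.inst fun _ => refl _) (List.forall₂_same.2 fun a _ => refl a)

end Howe

namespace Ciu

variable {c : Prop}

theorem lam {b b' : Tm} (h : Ciu c b b') : Ciu c (.lam b) (.lam b') :=
  (Howe.lam (.of_ciu h) (.refl _)).ciu

theorem app {f f' a a' : Tm} (hf : Ciu c f f') (ha : Ciu c a a') :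
    Ciu c (.app f a) (.app f' a') :=
  (Howe.app (.of_ciu hf) (.of_ciu ha) (.refl _)).ciu

theorem inst_congr {t t' : Tm} (h : Ciu c t t') {σ σ' : Nat → Tm} (hσ : ∀ i, Ciu c (σ i) (σ' i)) :
    Ciu c (t.inst σ) (t'.inst σ') :=
  ((Howe.of_ciu h).inst fun i => .of_ciu (hσ i)).ciu

theorem scons {a a' : Tm} (ha : Ciu c a a') {σ σ' : Nat → Tm} (hσ : ∀ i, Ciu c (σ i) (σ' i))
    (i : Nat) : Ciu c (Tm.scons a σ i) (Tm.scons a' σ' i) := by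
  cases i with
  | zero => exact ha
  | succ i => exact hσ i

theorem ev_congr {t t' : Tm} {L L' : List Tm} {n : Nat} (h : Ciu c t t')
    (hL : List.Forall₂ (Ciu c) L L') (he : Ev n t L) : ∃ m, (c → m ≤ n) ∧ Ev m t' L' :=
  Howe.ev he (.of_ciu h) (hL.imp fun _ _ => .of_ciu)

theorem plug {t t' : Tm} (h : Ciu c t t') (E : ECtx) : Ciu c (E.plug t) (E.plug t') := by
  induction E with
  | hole => exact h
  | appL E e ih => exact ih.app (.refl _)
  | appNeed B E _ ih => exact (Ciu.refl _).app ih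
  | appBody E e ih => exact ih.lam.app (.refl _)

end Ciu

theorem ev_redex_inst {n : Nat} {b a : Tm} {σ : Nat → Tm} {L : List Tm} :
    Ev n ((Tm.app (.lam b) a).inst σ) L ↔
      ∃ m, n = m + 1 ∧ Ev m (b.inst (Tm.scons (a.inst σ) σ)) L := by
  rw [Tm.inst, Tm.inst, ev_app, ev_lam_cons]
  simp only [Tm.inst_up_scons]

theorem ciu_beta {c : Prop} (b a : Tm) :
    Ciu c (.app (.lam b) a) (b.inst (Tm.scons a .bvar)) := by
  intro σ L n h
  obtain ⟨m, rfl, h⟩ := ev_redex_inst.1 h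
  exact ⟨m, fun _ => Nat.le_succ m, by rwa [Tm.inst_scons_inst]⟩

theorem ciu_beta_symm (b a : Tm) :
    Ciu False (b.inst (Tm.scons a .bvar)) (.app (.lam b) a) := by
  intro σ L n h
  rw [Tm.inst_scons_inst] at h
  exact ⟨n + 1, False.elim, ev_redex_inst.2 ⟨n, rfl, h⟩⟩

/-- Weak head evaluation of `E[r]` brings `r` to the head: a relation between configurations that
    is closed under prepending a pair of evaluation steps relates two plugged contexts once it
    relates the hole contents. -/
theorem plug_demand {c : Prop} {Q : Tm → List Tm → Tm → List Tm → Prop}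
    (hpush : ∀ {f a L f' a' L'}, Q f (a :: L) f' (a' :: L') → Q (.app f a) L (.app f' a') L')
    (hbeta : ∀ {b a L b' a' L'},
      Q (b.inst (Tm.scons a .bvar)) L (b'.inst (Tm.scons a' .bvar)) L' →
      Q (.lam b) (a :: L) (.lam b') (a' :: L'))
    (E : ECtx) {r r' : Tm} {σ σ' : Nat → Tm} {L L' : List Tm} (hr : Ciu c r r')
    (hσ : ∀ i, Ciu c (σ i) (σ' i)) (hL : List.Forall₂ (Ciu c) L L')
    (hQ : ∀ {τ τ' : Nat → Tm} {M M' : List Tm}, (∀ i, Ciu c (τ i) (τ' i)) →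
      (∀ i, τ (i + E.depth) = σ i) → (∀ i, τ' (i + E.depth) = σ' i) →
      List.Forall₂ (Ciu c) M M' → Q (r.inst τ) M (r'.inst τ') M') :
    Q ((E.plug r).inst σ) L ((E.plug r').inst σ') L' := by
  induction E generalizing r r' σ σ' L L' with
  | hole => exact hQ hσ (fun _ => rfl) (fun _ => rfl) hL
  | appL E e ih => exact hpush (ih hr hσ (.cons ((Ciu.refl e).inst_congr hσ) hL) hQ)
  | appBody E e ih =>
    refine hpush (hbeta ?_)
    rw [Tm.inst_up_scons, Tm.inst_up_scons]
    exact ih hr (((Ciu.refl e).inst_congr hσ).scons hσ) hL fun hτ h h' hM =>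
      hQ hτ (fun i => by rw [ECtx.depth, Nat.add_comm E.depth 1, ← Nat.add_assoc, h]; rfl)
        (fun i => by rw [ECtx.depth, Nat.add_comm E.depth 1, ← Nat.add_assoc, h']; rfl) hM
  | appNeed B E ihB ihE =>
    refine hpush (hbeta ?_)
    rw [Tm.inst_up_scons, Tm.inst_up_scons]
    refine ihB (.refl _) (((hr.plug E).inst_congr hσ).scons hσ) hL fun {τ τ' M M'} hτ h h' hM => ?_
    have h₀ := h 0
    have h₀' := h' 0
    rw [Nat.zero_add] at h₀ h₀'
    simp only [Tm.inst, h₀, h₀', Tm.scons]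
    exact ihE hr hσ hM hQ

/-! ### Call-by-need versus call-by-name evaluation -/

/-- `EvLt t L t' L'`: `t'` applied to `L'` evaluates in strictly fewer steps than `t` applied
    to `L`. -/
def EvLt (t : Tm) (L : List Tm) (t' : Tm) (L' : List Tm) : Prop :=
  ∀ n, Ev n t L → ∃ m, m < n ∧ Ev m t' L'

theorem EvLt.push {f a f' a' : Tm} {L L' : List Tm} (h : EvLt f (a :: L) f' (a' :: L')) :
    EvLt (.app f a) L (.app f' a') L' := fun n he => by
  obtain ⟨m, hm, he⟩ := h n (ev_app.1 he)
  exact ⟨m, hm, .push he⟩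

theorem EvLt.beta {b a b' a' : Tm} {L L' : List Tm}
    (h : EvLt (b.inst (Tm.scons a .bvar)) L (b'.inst (Tm.scons a' .bvar)) L') :
    EvLt (.lam b) (a :: L) (.lam b') (a' :: L') := fun n he => by
  obtain ⟨k, rfl, hk⟩ := ev_lam_cons.1 he
  obtain ⟨m, hm, he⟩ := h k hk
  exact ⟨m + 1, Nat.succ_lt_succ hm, .beta he⟩

/-- A head redex evaluates strictly slower than any improvement of its contractum. -/
theorem EvLt.redex {b a t' : Tm} {σ : Nat → Tm} {L L' : List Tm}
    (h : Ciu True ((b.inst (Tm.scons a .bvar)).inst σ) t')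
    (hL : List.Forall₂ (Ciu True) L L') :
    EvLt ((Tm.app (.lam b) a).inst σ) L t' L' := by
  intro n he
  obtain ⟨k, rfl, hk⟩ := ev_redex_inst.1 he
  rw [← Tm.inst_scons_inst] at hk
  obtain ⟨m, hm, he⟩ := h.ev_congr hL hk
  exact ⟨m, Nat.lt_succ_of_le (hm trivial), he⟩

theorem evLt_plug_beta (E : ECtx) (b a : Tm) :
    EvLt (E.plug (.app (.lam b) a)) [] (E.plug (b.inst (Tm.scons a .bvar))) [] := by
  have := plug_demand (Q := EvLt) (σ := .bvar) (σ' := .bvar) EvLt.push EvLt.beta E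
    (ciu_beta (c := True) b a) (fun i => .refl _) .nil
    (fun hτ _ _ hM => EvLt.redex ((Ciu.refl _).inst_congr hτ) hM)
  simpa using this

theorem not_ev_plug_bvar (E : ECtx) (i n : Nat) : ¬ Ev n (E.plug (.bvar (i + E.depth))) [] := by
  have := plug_demand (c := True) (Q := fun t L _ _ => ∀ n, ¬ Ev n t L)
    (σ := .bvar) (σ' := .bvar) (r := .bvar (i + E.depth)) (L := []) (L' := [])
    (fun h n he => h n (ev_app.1 he))
    (fun h n he => by obtain ⟨m, _, he⟩ := ev_lam_cons.1 he; exact h m he)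
    E (.refl _) (fun i => .refl _) .nil
    (fun hτ h _ _ n he => by rw [Tm.inst, h] at he; exact not_ev_bvar he)
  simpa using this n

theorem ciu_lift {c : Prop} (a e e' : Tm) :
    Ciu c (.app (.app (.lam a) e) e') (.app (.lam (.app a (e'.lift 1 0))) e) := by
  intro σ L n h
  rw [Tm.inst, ev_app] at h
  obtain ⟨m, rfl, h⟩ := ev_redex_inst.1 h
  refine ⟨m + 1, fun _ => le_rfl, ev_redex_inst.2 ⟨m, rfl, ?_⟩⟩
  rwa [Tm.inst, ev_app, Tm.lift_one_inst_scons]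

theorem ciu_lift_symm {c : Prop} (a e e' : Tm) :
    Ciu c (.app (.lam (.app a (e'.lift 1 0))) e) (.app (.app (.lam a) e) e') := by
  intro σ L n h
  obtain ⟨m, rfl, hm⟩ := ev_redex_inst.1 h
  rw [Tm.inst, ev_app, Tm.lift_one_inst_scons] at hm
  exact ⟨m + 1, fun _ => le_rfl, .push (ev_redex_inst.2 ⟨m, rfl, hm⟩)⟩

theorem ev_assoc_inst {n : Nat} {b a e : Tm} {σ : Nat → Tm} {L : List Tm} :
    Ev n ((Tm.app (.lam (.app ((Tm.lam b).lift 1 0) a)) e).inst σ) L ↔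
      ∃ m, n = m + 2 ∧
        Ev m (b.inst (Tm.scons ((a.inst (Tm.scons e .bvar)).inst σ) σ)) L := by
  rw [ev_redex_inst]
  simp only [Tm.inst, ev_app, Tm.lift_one_inst_scons, ev_lam_cons, Tm.inst_up_scons,
    Tm.inst_scons_inst]
  constructor
  · rintro ⟨_, rfl, m, rfl, h⟩
    exact ⟨m, rfl, h⟩
  · rintro ⟨m, rfl, h⟩
    exact ⟨_, rfl, m, rfl, h⟩

theorem ciu_assoc (E : ECtx) (a e : Tm) :
    Ciu True (.app (.lam (E.plug (.bvar E.depth))) (.app (.lam a) e))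
      (.app (.lam (.app ((Tm.lam (E.plug (.bvar E.depth))).lift 1 0) a)) e) := by
  intro σ L n h
  obtain ⟨k, rfl, hk⟩ := ev_redex_inst.1 h
  obtain ⟨m, hm, h⟩ := plug_demand (Q := EvLt)
    (σ' := Tm.scons ((a.inst (Tm.scons e .bvar)).inst σ) σ) EvLt.push EvLt.beta E (.refl _)
    (((ciu_beta (c := True) a e).inst σ).scons fun _ => .refl _)
    (List.forall₂_same.2 fun a _ => .refl a)
    (fun {τ τ' M M'} _ h h' hM => by
      have h₀ := h 0
      have h₀' := h' 0
      rw [Nat.zero_add] at h₀ h₀'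
      rw [Tm.inst, h₀, Tm.inst, h₀']
      exact EvLt.redex (.refl _) hM) k hk
  exact ⟨m + 2, fun _ => by omega, ev_assoc_inst.2 ⟨m, rfl, h⟩⟩

theorem ciu_assoc_symm (b a e : Tm) :
    Ciu False (.app (.lam (.app ((Tm.lam b).lift 1 0) a)) e)
      (.app (.lam b) (.app (.lam a) e)) := by
  intro σ L n h
  obtain ⟨m, rfl, hm⟩ := ev_assoc_inst.1 h
  obtain ⟨k, -, h⟩ := ((Ciu.refl b).inst_congr
    (((ciu_beta_symm a e).inst σ).scons fun _ => Ciu.refl _)).ev hm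
  exact ⟨k + 1, False.elim, ev_redex_inst.2 ⟨k, rfl, h⟩⟩

/-- A measure decreased by `lift` and `assoc` in evaluation contexts. -/
def weight : Tm → Nat
  | .bvar _ => 1
  | .lam b => weight b
  | .app f a => (match f with | .lam _ => 1 | _ => 2) * weight f + 2 * weight a

theorem weight_pos (t : Tm) : 0 < weight t := by
  induction t with
  | bvar i => exact Nat.one_pos
  | lam b ih => exact ih
  | app f a _ iha => simp only [weight]; omega

theorem weight_lift (n k : Nat) (t : Tm) : weight (t.lift n k) = weight t := by
  induction t generalizing k with
  | bvar i => simp only [Tm.lift]; split <;> rfl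
  | lam b ih => exact ih _
  | app f a ihf iha =>
    simp only [Tm.lift, weight, ihf, iha]
    cases f with
    | bvar i => by_cases h : i < k <;> simp [Tm.lift, h]
    | lam b => rfl
    | app f a => rfl

theorem ECtx.plug_app (E : ECtx) (f a : Tm) : ∃ g b, E.plug (.app f a) = .app g b := by
  cases E <;> exact ⟨_, _, rfl⟩

theorem weight_plug_lt (E : ECtx) {f a f' a' : Tm}
    (h : weight (.app f' a') < weight (.app f a)) :
    weight (E.plug (.app f' a')) < weight (E.plug (.app f a)) := by
  induction E with
  | hole => exact h
  | appL E e ih =>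
    obtain ⟨g, b, hg⟩ := E.plug_app f a
    obtain ⟨g', b', hg'⟩ := E.plug_app f' a'
    rw [hg, hg'] at ih
    rw [ECtx.plug, ECtx.plug, hg, hg']
    change 2 * weight (.app g' b') + _ < 2 * weight (.app g b) + _
    omega
  | appNeed B E _ ih => simp only [ECtx.plug, weight]; omega
  | appBody E e ih => simp only [ECtx.plug, weight]; omega

theorem weight_lift_lt (a e e' : Tm) :
    weight (.app (.lam (.app a (e'.lift 1 0))) e) < weight (.app (.app (.lam a) e) e') := by
  have := weight_pos e
  have := weight_pos a
  cases a <;> simp only [weight, weight_lift] at * <;> omega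

theorem weight_assoc_lt (b a e : Tm) :
    weight (.app (.lam (.app ((Tm.lam b).lift 1 0) a)) e) <
      weight (.app (.lam b) (.app (.lam a) e)) := by
  have := weight_pos e
  simp only [Tm.lift, weight, weight_lift]
  omega

theorem StdStep.ev {t t' : Tm} (h : StdStep t t') {n : Nat} (he : Ev n t []) :
    ∃ m, Ev m t' [] ∧ (m < n ∨ m ≤ n ∧ weight t' < weight t) := by
  obtain ⟨E, r, r', hr⟩ := h
  cases hr with
  | beta E' b =>
    rw [Tm.subst_zero_eq_inst]
    obtain ⟨m, hm, he⟩ := evLt_plug_beta E _ _ n he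
    exact ⟨m, he, .inl hm⟩
  | liftR e e' =>
    obtain ⟨m, hm, he⟩ := ((ciu_lift (c := True) _ e e').plug E).ev he
    exact ⟨m, he, .inr ⟨hm trivial, weight_plug_lt E (weight_lift_lt _ _ _)⟩⟩
  | assoc E' e =>
    obtain ⟨m, hm, he⟩ := ((ciu_assoc E' _ e).plug E).ev he
    exact ⟨m, he, .inr ⟨hm trivial, weight_plug_lt E (weight_assoc_lt _ _ _)⟩⟩

theorem StdStep.ciu_symm {t t' : Tm} (h : StdStep t t') : Ciu False t' t := by
  obtain ⟨E, r, r', hr⟩ := h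
  refine Ciu.plug ?_ E
  cases hr with
  | beta E' b => rw [Tm.subst_zero_eq_inst]; exact ciu_beta_symm _ _
  | liftR e e' => exact ciu_lift_symm _ _ _
  | assoc E' e => exact ciu_assoc_symm _ _ _

theorem IsAnswer.ev_inst {a : Tm} (h : IsAnswer a) (σ : Nat → Tm) : ∃ n, Ev n (a.inst σ) [] := by
  induction h generalizing σ with
  | lam b => exact ⟨0, .lam _⟩
  | app e _ ih =>
    obtain ⟨n, hn⟩ := ih (Tm.scons (e.inst σ) σ)
    exact ⟨n + 1, ev_redex_inst.2 ⟨n, rfl, hn⟩⟩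

theorem StdStep.appL {f f' : Tm} (h : StdStep f f') (a : Tm) :
    StdStep (.app f a) (.app f' a) := by
  obtain ⟨E, r, r', hr⟩ := h
  exact .mk (.appL E a) r r' hr

theorem StdStep.appBody {b b' : Tm} (h : StdStep b b') (a : Tm) :
    StdStep (.app (.lam b) a) (.app (.lam b') a) := by
  obtain ⟨E, r, r', hr⟩ := h
  exact .mk (.appBody E a) r r' hr

theorem StdStep.appNeed (B : ECtx) {a a' : Tm} (h : StdStep a a') :
    StdStep (.app (.lam (B.plug (.bvar B.depth))) a)
      (.app (.lam (B.plug (.bvar B.depth))) a') := by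
  obtain ⟨E, r, r', hr⟩ := h
  exact .mk (.appNeed B E) r r' hr

/-- Every term is an answer, or demands a free variable, or takes a standard step. -/
theorem need_progress (t : Tm) :
    IsAnswer t ∨ (∃ E i, t = ECtx.plug E (.bvar (i + E.depth))) ∨ ∃ t', StdStep t t' := by
  match t with
  | .bvar i => exact .inr (.inl ⟨.hole, i, rfl⟩)
  | .lam b => exact .inl (.lam b)
  | .app (.lam b) a =>
    rcases need_progress b with hb | ⟨E, i, rfl⟩ | ⟨b', hb⟩
    · exact .inl (.app a hb)
    · cases i with
      | succ i =>
        refine .inr (.inl ⟨.appBody E a, i, ?_⟩)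
        rw [ECtx.plug, ECtx.depth, Nat.succ_add_eq_add_succ]
      | zero =>
        rw [Nat.zero_add]
        rcases need_progress a with ha | ⟨E', i, rfl⟩ | ⟨a', ha⟩
        · cases ha with
          | lam b => exact .inr (.inr ⟨_, .mk .hole _ _ (.beta E b)⟩)
          | app e ha => exact .inr (.inr ⟨_, .mk .hole _ _ (.assoc E e ha)⟩)
        · exact .inr (.inl ⟨.appNeed E E', i, rfl⟩)
        · exact .inr (.inr ⟨_, ha.appNeed E⟩)
    · exact .inr (.inr ⟨_, hb.appBody a⟩)
  | .app (.bvar i) a => exact .inr (.inl ⟨.appL .hole a, i, rfl⟩)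
  | .app (.app g d) a =>
    rcases need_progress (.app g d) with hf | ⟨E, i, hE⟩ | ⟨f', hf⟩
    · cases hf with
      | app _ hf => exact .inr (.inr ⟨_, .mk .hole _ _ (.liftR d a hf)⟩)
    · exact .inr (.inl ⟨.appL E a, i, by rw [hE]; rfl⟩)
    · exact .inr (.inr ⟨_, hf.appL a⟩)

theorem need_answer_of_ev (n : Nat) (t : Tm) (he : Ev n t []) :
    ∃ a, IsAnswer a ∧ Relation.ReflTransGen StdStep t a := by
  rcases need_progress t with ha | ⟨E, i, rfl⟩ | ⟨t', hs⟩
  · exact ⟨t, ha, .refl⟩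
  · exact absurd he (not_ev_plug_bvar E i n)
  · obtain ⟨m, hm, hlt⟩ := hs.ev he
    obtain ⟨a, ha, hr⟩ := need_answer_of_ev m t' hm
    exact ⟨a, ha, .head hs hr⟩
termination_by (n, weight t)
decreasing_by
  rcases hlt with h | ⟨h, hw⟩
  · exact Prod.Lex.left _ _ h
  · rcases h.lt_or_eq with h | rfl
    · exact Prod.Lex.left _ _ h
    · exact Prod.Lex.right _ hw

theorem need_answer_iff_ev (t : Tm) :
    (∃ a, IsAnswer a ∧ Relation.ReflTransGen StdStep t a) ↔ ∃ n, Ev n t [] := by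
  refine ⟨?_, fun ⟨n, h⟩ => need_answer_of_ev n t h⟩
  rintro ⟨a, ha, hr⟩
  induction hr using Relation.ReflTransGen.head_induction_on with
  | refl => simpa using ha.ev_inst .bvar
  | head hs _ ih =>
    obtain ⟨n, hn⟩ := ih
    obtain ⟨m, -, hm⟩ := hs.ciu_symm.ev hn
    exact ⟨m, hm⟩

/-! ### Labeled rewriting versus call-by-name evaluation -/

namespace LTm

/-- Erase all labels. -/
def erase : LTm → Tm
  | .bvar i => .bvar i
  | .lam b => .lam (erase b)
  | .app f a => .app (erase f) (erase a)
  | .lab _ e => erase e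

/-- `Coherent h k t`: `t` is closed under `k` binders, and every labeled subexpression `ℓ:u` of
    `t` is closed with `u = h ℓ`. -/
def Coherent (h : Nat → LTm) : Nat → LTm → Prop
  | k, .bvar i => i < k
  | k, .lam b => Coherent h (k + 1) b
  | k, .app f a => Coherent h k f ∧ Coherent h k a
  | _, .lab ℓ e => e = h ℓ ∧ Coherent h 0 e

theorem erase_lift (n k : Nat) (t : LTm) : (t.lift n k).erase = t.erase.lift n k := by
  induction t generalizing k with
  | bvar i => simp only [lift, Tm.lift, erase]; split <;> rfl
  | lam b ih => simp [lift, Tm.lift, erase, ih]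
  | app f a ihf iha => simp [lift, Tm.lift, erase, ihf, iha]
  | lab ℓ e ih => simp [lift, erase, ih]

theorem erase_subst (t : LTm) (k : Nat) (s : LTm) :
    (t.subst k s).erase = t.erase.subst k s.erase := by
  induction t generalizing k with
  | bvar i =>
    simp only [subst, Tm.subst, erase]
    split_ifs
    · exact erase_lift k 0 s
    · rfl
    · rfl
  | lam b ih => simp [subst, Tm.subst, erase, ih]
  | app f a ihf iha => simp [subst, Tm.subst, erase, ihf, iha]
  | lab ℓ e ih => simp [subst, erase, ih]

theorem erase_toL (e : Tm) : (toL e).erase = e := by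
  induction e <;> simp_all [toL, erase]

theorem erase_wrapped {t u : LTm} (h : LWrapped t u) : t.erase = u.erase := by
  induction h with
  | refl e => rfl
  | lab ℓ _ ih => exact ih

namespace Coherent

variable {h : Nat → LTm}

theorem mono {j k : Nat} {t : LTm} (ht : Coherent h j t) (hjk : j ≤ k) : Coherent h k t := by
  induction t generalizing j k with
  | bvar i => exact Nat.lt_of_lt_of_le ht hjk
  | lam b ih => exact ih ht (Nat.succ_le_succ hjk)
  | app f a ihf iha => exact ⟨ihf ht.1 hjk, iha ht.2 hjk⟩
  | lab ℓ e ih => exact ht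

theorem lift_eq {k j : Nat} {t : LTm} (ht : Coherent h k t) (hkj : k ≤ j) (n : Nat) :
    t.lift n j = t := by
  induction t generalizing j k with
  | bvar i => exact if_pos (Nat.lt_of_lt_of_le ht hkj)
  | lam b ih => rw [lift, ih ht (Nat.succ_le_succ hkj)]
  | app f a ihf iha => rw [lift, ihf ht.1 hkj, iha ht.2 hkj]
  | lab ℓ e ih => rw [lift, ih ht.2 (Nat.zero_le j)]

theorem subst_eq {k j : Nat} {t : LTm} (ht : Coherent h k t) (hkj : k ≤ j) (s : LTm) :
    t.subst j s = t := by
  induction t generalizing j k with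
  | bvar i =>
    have : i < k := ht
    rw [LTm.subst, if_neg (by omega), if_neg (by omega)]
  | lam b ih => rw [LTm.subst, ih ht (Nat.succ_le_succ hkj)]
  | app f a ihf iha => rw [LTm.subst, ihf ht.1 hkj, iha ht.2 hkj]
  | lab ℓ e ih => rw [LTm.subst, ih ht.2 (Nat.zero_le j)]

theorem subst {k : Nat} {t s : LTm} (ht : Coherent h (k + 1) t) (hs : Coherent h 0 s) :
    Coherent h k (t.subst k s) := by
  induction t generalizing k with
  | bvar i =>
    have hi : i < k + 1 := ht
    rw [LTm.subst]
    split_ifs with h₁ h₂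
    · rw [hs.lift_eq le_rfl]
      exact hs.mono (Nat.zero_le k)
    · omega
    · exact show i < k by omega
  | lam b ih => exact ih ht
  | app f a ihf iha => exact ⟨ihf ht.1, iha ht.2⟩
  | lab ℓ e ih =>
    rw [LTm.subst, ht.2.subst_eq (Nat.zero_le k)]
    exact ht

theorem sizeOf_lt {k ℓ : Nat} {t : LTm} (ht : Coherent h k t) (hℓ : hasLab ℓ t) :
    sizeOf (h ℓ) < sizeOf t := by
  induction t generalizing k with
  | bvar i => exact hℓ.elim
  | lam b ih =>
    have := ih ht hℓ
    simp only [lam.sizeOf_spec]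
    omega
  | app f a ihf iha =>
    simp only [app.sizeOf_spec]
    rcases hℓ with hℓ | hℓ
    · have := ihf ht.1 hℓ
      omega
    · have := iha ht.2 hℓ
      omega
  | lab ℓ' e ih =>
    simp only [lab.sizeOf_spec]
    rcases hℓ with rfl | hℓ
    · rw [← ht.1]
      omega
    · have := ih ht.2 hℓ
      omega

/-- A labeled expression does not contain its own label. -/
theorem not_hasLab_self {k ℓ : Nat} {u : LTm} (ht : Coherent h k (.lab ℓ u)) : ¬ hasLab ℓ u := by
  intro hℓ
  have := ht.2.sizeOf_lt hℓ
  rw [← ht.1] at this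
  exact lt_irrefl _ this

theorem congr_labels {h' : Nat → LTm} {k : Nat} {t : LTm} (ht : Coherent h k t)
    (hh : ∀ ℓ, hasLab ℓ t → h' ℓ = h ℓ) : Coherent h' k t := by
  induction t generalizing k with
  | bvar i => exact ht
  | lam b ih => exact ih ht hh
  | app f a ihf iha =>
    exact ⟨ihf ht.1 fun ℓ hℓ => hh ℓ (.inl hℓ), iha ht.2 fun ℓ hℓ => hh ℓ (.inr hℓ)⟩
  | lab ℓ e ih => exact ⟨by rw [hh ℓ (.inl rfl)]; exact ht.1, ih ht.2 fun ℓ hℓ => hh ℓ (.inr hℓ)⟩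

theorem wrapped {t u : LTm} (ht : Coherent h 0 t) (hw : LWrapped t u) : Coherent h 0 u := by
  induction hw with
  | refl e => exact ht
  | lab ℓ _ ih => exact ih ht.2

theorem of_plug {E : LCtx} {t : LTm} (ht : Coherent h 0 (E.plug t)) : Coherent h 0 t := by
  induction E with
  | hole => exact ht
  | appL E e ih => exact ih ht.1
  | labC ℓ E ih => exact ih ht.2

theorem plug_noLab {E : LCtx} {t t' : LTm} (ht : Coherent h 0 (E.plug t)) (hE : E.noLab)
    (ht' : Coherent h 0 t') : Coherent h 0 (E.plug t') := by
  induction E with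
  | hole => exact ht'
  | appL E e ih => exact ⟨ih ht.1 hE, ht.2⟩
  | labC ℓ E ih => exact hE.elim

end Coherent

theorem update_eq_self {ℓ : Nat} {t : LTm} (ht : ¬ hasLab ℓ t) (new : LTm) :
    update ℓ new t = t := by
  induction t with
  | bvar i => rfl
  | lam b ih => rw [update, ih ht]
  | app f a ihf iha => rw [update, ihf fun h => ht (.inl h), iha fun h => ht (.inr h)]
  | lab ℓ' e ih =>
    rw [update, if_neg fun h => ht (.inl h.symm), ih fun h => ht (.inr h)]

/-- The label contents after a parallel update. -/
def updateLabels (h : Nat → LTm) (ℓ : Nat) (new : LTm) : Nat → LTm :=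
  fun j => if j = ℓ then new else update ℓ new (h j)

namespace Coherent

variable {h : Nat → LTm}

theorem updateLabels_of_not_hasLab {k ℓ : Nat} {t : LTm} (ht : Coherent h k t)
    (hℓ : ¬ hasLab ℓ t) (new : LTm) : Coherent (updateLabels h ℓ new) k t := by
  induction t generalizing k with
  | bvar i => exact ht
  | lam b ih => exact ih ht hℓ
  | app f a ihf iha => exact ⟨ihf ht.1 fun h => hℓ (.inl h), iha ht.2 fun h => hℓ (.inr h)⟩
  | lab j e ih =>
    refine ⟨?_, ih ht.2 fun h => hℓ (.inr h)⟩
    rw [updateLabels, if_neg fun h => hℓ (.inl h.symm), ← ht.1,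
      update_eq_self fun h => hℓ (.inr h)]

theorem update {k ℓ : Nat} {t new : LTm} (ht : Coherent h k t)
    (hnew : Coherent (updateLabels h ℓ new) 0 new) :
    Coherent (updateLabels h ℓ new) k (update ℓ new t) := by
  induction t generalizing k with
  | bvar i => exact ht
  | lam b ih => exact ih ht
  | app f a ihf iha => exact ⟨ihf ht.1, iha ht.2⟩
  | lab j e ih =>
    rw [LTm.update]
    split_ifs with hj
    · exact ⟨by simp [updateLabels, hj], hnew⟩
    · exact ⟨by simp [updateLabels, hj, ← ht.1], ih ht.2⟩

/-- Updating a label with an expression related to its content relates the erasures. -/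
theorem erase_update {S : Tm → Tm → Prop} (hrefl : ∀ t, S t t)
    (hlam : ∀ {b b'}, S b b' → S (.lam b) (.lam b'))
    (happ : ∀ {f f' a a'}, S f f' → S a a' → S (.app f a) (.app f' a'))
    {k ℓ : Nat} {t new : LTm} (ht : Coherent h k t) (hS : S (h ℓ).erase new.erase) :
    S t.erase (LTm.update ℓ new t).erase := by
  induction t generalizing k with
  | bvar i => exact hrefl _
  | lam b ih => exact hlam (ih ht)
  | app f a ihf iha => exact happ (ihf ht.1) (iha ht.2)
  | lab j e ih =>
    rw [LTm.update]
    split_ifs with hj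
    · subst hj
      rwa [erase, erase, ht.1]
    · exact ih ht.2

end Coherent

theorem hasLab_of_lift {n k ℓ : Nat} {t : LTm} (h : hasLab ℓ (t.lift n k)) : hasLab ℓ t := by
  induction t generalizing k with
  | bvar i => simp only [lift] at h; split at h <;> exact h
  | lam b ih => exact ih h
  | app f a ihf iha => exact h.imp ihf iha
  | lab j e ih => exact h.imp_right ih

theorem hasLab_of_subst {k ℓ : Nat} {t s : LTm} (h : hasLab ℓ (t.subst k s)) :
    hasLab ℓ t ∨ hasLab ℓ s := by
  induction t generalizing k with
  | bvar i =>
    rw [subst] at h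
    split_ifs at h
    · exact .inr (hasLab_of_lift h)
    · exact h.elim
    · exact h.elim
  | lam b ih => exact ih h
  | app f a ihf iha =>
    rcases h with h | h
    · exact (ihf h).imp_left .inl
    · exact (iha h).imp_left .inr
  | lab j e ih =>
    rcases h with h | h
    · exact .inl (.inl h)
    · exact (ih h).imp_left .inr

theorem hasLab_of_wrapped {t u : LTm} {ℓ : Nat} (hw : LWrapped t u) (h : hasLab ℓ u) :
    hasLab ℓ t := by
  induction hw with
  | refl e => exact h
  | lab ℓ' _ ih => exact .inr (ih h)

theorem exists_bound (t : LTm) : ∃ N, ∀ ℓ, hasLab ℓ t → ℓ < N := by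
  induction t with
  | bvar i => exact ⟨0, fun _ h => h.elim⟩
  | lam b ih => exact ih
  | app f a ihf iha =>
    obtain ⟨N, hN⟩ := ihf
    obtain ⟨M, hM⟩ := iha
    refine ⟨max N M, fun ℓ h => ?_⟩
    rcases h with h | h
    · exact lt_max_of_lt_left (hN ℓ h)
    · exact lt_max_of_lt_right (hM ℓ h)
  | lab j e ih =>
    obtain ⟨N, hN⟩ := ih
    refine ⟨max N (j + 1), fun ℓ h => ?_⟩
    rcases h with rfl | h
    · exact lt_max_of_lt_right ℓ.lt_succ_self
    · exact lt_max_of_lt_left (hN ℓ h)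

theorem exists_fresh (t : LTm) : ∃ ℓ, ¬ hasLab ℓ t := by
  obtain ⟨N, hN⟩ := exists_bound t
  exact ⟨N, fun h => lt_irrefl _ (hN N h)⟩

end LTm

open LTm

theorem hasLab_plug {E : LCtx} {t : LTm} {ℓ : Nat} (h : hasLab ℓ t) : hasLab ℓ (E.plug t) := by
  induction E with
  | hole => exact h
  | appL E e ih => exact .inl ih
  | labC j E ih => exact .inr ih

theorem hasLab_of_plug_noLab {E : LCtx} (hE : E.noLab) {t t' : LTm} {ℓ : Nat}
    (h : hasLab ℓ (E.plug t')) : hasLab ℓ (E.plug t) ∨ hasLab ℓ t' := by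
  induction E with
  | hole => exact .inr h
  | appL E e ih =>
    rcases h with h | h
    · exact (ih hE h).imp_left .inl
    · exact .inl (.inr h)
  | labC j E ih => exact hE.elim

theorem ciu_erase_plug {c : Prop} {t t' : LTm} (h : Ciu c t.erase t'.erase) (E : LCtx) :
    Ciu c (E.plug t).erase (E.plug t').erase := by
  induction E with
  | hole => exact h
  | appL E e ih => exact ih.app (.refl _)
  | labC ℓ E ih => exact ih

theorem evLt_erase_plug {t t' : LTm} (h : ∀ L, EvLt t.erase L t'.erase L) (E : LCtx)
    (L : List Tm) : EvLt (E.plug t).erase L (E.plug t').erase L := by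
  induction E generalizing L with
  | hole => exact h L
  | appL E e ih => exact (ih _).push
  | labC ℓ E ih => exact ih L

theorem update_plug_lab (E : LCtx) (ℓ : Nat) (new t t' : LTm) :
    update ℓ new (E.plug (.lab ℓ t)) = update ℓ new (E.plug (.lab ℓ t')) := by
  induction E with
  | hole => simp [LCtx.plug, update]
  | appL E e ih => rw [LCtx.plug, LCtx.plug, update, update, ih]
  | labC j E ih => rw [LCtx.plug, LCtx.plug, update, update, ih]

theorem ciu_erase_update_plug {c : Prop} {h : Nat → LTm} (E : LCtx) {ℓ : Nat} {u new : LTm}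
    (hc : Coherent h 0 (E.plug (.lab ℓ u))) (hu : Ciu c (h ℓ).erase new.erase) :
    Ciu c (E.plug (.lab ℓ new)).erase (update ℓ new (E.plug (.lab ℓ new))).erase := by
  induction E with
  | hole => rw [LCtx.plug, update, if_pos rfl]; exact .refl _
  | appL E e ih =>
    exact (ih hc.1).app (hc.2.erase_update Ciu.refl Ciu.lam Ciu.app hu)
  | labC j E ih =>
    have hj : j ≠ ℓ := by
      rintro rfl
      exact hc.not_hasLab_self (hasLab_plug (.inl rfl))
    rw [LCtx.plug, update, if_neg hj]
    exact ih hc.2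

namespace LContr

variable {P r r' : LTm}

theorem erase_eq (hr : LContr P r r') :
    ∃ b a, r.erase = .app (.lam b) a ∧ r'.erase = b.inst (Tm.scons a .bvar) := by
  obtain ⟨b, e, ℓ, hw, -⟩ := hr
  refine ⟨b.erase, e.erase, ?_, ?_⟩
  · rw [erase, erase_wrapped hw, erase]
  · rw [erase_subst, Tm.subst_zero_eq_inst, erase]

theorem ciu (hr : LContr P r r') {c : Prop} : Ciu c r.erase r'.erase := by
  obtain ⟨b, a, h, h'⟩ := hr.erase_eq
  rw [h, h']
  exact ciu_beta b a

theorem ciu_symm (hr : LContr P r r') : Ciu False r'.erase r.erase := by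
  obtain ⟨b, a, h, h'⟩ := hr.erase_eq
  rw [h, h']
  exact ciu_beta_symm b a

theorem evLt (hr : LContr P r r') (L : List Tm) : EvLt r.erase L r'.erase L := by
  obtain ⟨b, a, h, h'⟩ := hr.erase_eq
  rw [h, h']
  have := EvLt.redex (b := b) (a := a) (σ := .bvar) (L := L) (.refl _)
    (List.forall₂_same.2 fun a _ => .refl a)
  simpa using this

/-- The label contents extend to cover the fresh label created by a contraction. -/
theorem coherent (hr : LContr P r r') {h : Nat → LTm} (hP : Coherent h 0 P)
    (hc : Coherent h 0 r) (hsub : ∀ ℓ, hasLab ℓ r → hasLab ℓ P) :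
    ∃ h', Coherent h' 0 P ∧ Coherent h' 0 r' ∧ ∀ ℓ, hasLab ℓ P → h' ℓ = h ℓ := by
  obtain ⟨b, e, ℓ, hw, hℓ⟩ := hr
  have hh : ∀ j, hasLab j P → Function.update h ℓ e j = h j := fun j hj =>
    Function.update_of_ne (by rintro rfl; exact hℓ hj) _ _
  have hc' := hc.congr_labels fun j hj => hh j (hsub j hj)
  refine ⟨_, hP.congr_labels hh, ?_, hh⟩
  exact Coherent.subst (hc'.1.wrapped hw) ⟨by simp, hc'.2⟩

theorem not_hasLab (hr : LContr P r r') {ℓ : Nat} (hP : hasLab ℓ P) (hℓ : ¬ hasLab ℓ r) :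
    ¬ hasLab ℓ r' := by
  obtain ⟨b, e, ℓ', hw, hℓ'⟩ := hr
  intro h
  rcases hasLab_of_subst h with h | rfl | h
  · exact hℓ (.inl (hasLab_of_wrapped hw h))
  · exact hℓ' hP
  · exact hℓ (.inr h)

end LContr

/-- A labeled rewriting step preserves coherence, does not change whether the erasure evaluates,
    and makes its evaluation strictly shorter. -/
theorem LStep.erase {P P' : LTm} (hs : LStep P P') {h : Nat → LTm} (hP : Coherent h 0 P) :
    (∃ h', Coherent h' 0 P') ∧ Ciu False P'.erase P.erase ∧ EvLt P.erase [] P'.erase [] := by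
  cases hs with
  | noLab E r r' hE hr =>
    obtain ⟨h', hP', hr', -⟩ := hr.coherent hP hP.of_plug fun _ => hasLab_plug
    exact ⟨⟨h', hP'.plug_noLab hE hr'⟩, ciu_erase_plug hr.ciu_symm E,
      evLt_erase_plug hr.evLt E []⟩
  | underLab E₁ E₂ ℓ r r' hE₂ hr =>
    have hlab : Coherent h 0 (.lab ℓ (E₂.plug r)) := hP.of_plug
    have hu : h ℓ = E₂.plug r := hlab.1.symm
    have hP_lab : hasLab ℓ (E₁.plug (.lab ℓ (E₂.plug r))) := hasLab_plug (.inl rfl)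
    have heq := update_plug_lab E₁ ℓ (E₂.plug r') (E₂.plug r') (E₂.plug r)
    refine ⟨?_, ?_, ?_⟩
    · obtain ⟨h', hP', hr', -⟩ := hr.coherent hP hlab.2.of_plug
        fun j hj => hasLab_plug (.inr (hasLab_plug hj))
      have hlab' : Coherent h' 0 (.lab ℓ (E₂.plug r)) := hP'.of_plug
      have hnew : ¬ hasLab ℓ (E₂.plug r') := by
        intro hℓ
        rcases hasLab_of_plug_noLab (t := r) hE₂ hℓ with hℓ | hℓ
        · exact hlab.not_hasLab_self hℓ
        · exact hr.not_hasLab hP_lab (fun hj => hlab.not_hasLab_self (hasLab_plug hj)) hℓ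
      rw [heq]
      exact ⟨_, hP'.update
        ((hlab'.2.plug_noLab hE₂ hr').updateLabels_of_not_hasLab hnew _)⟩
    · rw [heq]
      refine hP.erase_update (S := fun t t' => Ciu False t' t) Ciu.refl Ciu.lam Ciu.app ?_
      rw [hu]
      exact ciu_erase_plug hr.ciu_symm E₂
    · intro n he
      obtain ⟨m, hm, he⟩ := evLt_erase_plug (evLt_erase_plug hr.evLt (.labC ℓ E₂)) E₁ [] n he
      have hc := ciu_erase_update_plug (c := True) (new := E₂.plug r') E₁ hP
        (by rw [hu]; exact ciu_erase_plug hr.ciu E₂)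
      obtain ⟨k, hk, he⟩ := hc.ev he
      exact ⟨k, (hk trivial).trans_lt hm, he⟩

theorem LVal.wrapped {v : LTm} (hv : LVal v) : ∃ b, LWrapped v (.lam b) := by
  induction hv with
  | lam b => exact ⟨b, .refl _⟩
  | lab ℓ _ ih =>
    obtain ⟨b, hb⟩ := ih
    exact ⟨b, .lab ℓ hb⟩

theorem lval_or_redex {h : Nat → LTm} {t : LTm} (ht : Coherent h 0 t) :
    LVal t ∨ ∃ E f e b, t = LCtx.plug E (.app f e) ∧ LWrapped f (.lam b) := by
  induction t with
  | bvar i => exact absurd ht (Nat.not_lt_zero i)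
  | lam b => exact .inl (.lam b)
  | app f a ihf _ =>
    rcases ihf ht.1 with hv | ⟨E, g, e, b, rfl, hb⟩
    · obtain ⟨b, hb⟩ := hv.wrapped
      exact .inr ⟨.hole, f, a, b, rfl, hb⟩
    · exact .inr ⟨.appL E a, g, e, b, rfl, hb⟩
  | lab ℓ u ih =>
    rcases ih ht.2 with hv | ⟨E, g, e, b, rfl, hb⟩
    · exact .inl (.lab ℓ hv)
    · exact .inr ⟨.labC ℓ E, g, e, b, rfl, hb⟩

/-- A context is label-free or splits at its innermost label. -/
theorem LCtx.noLab_or_split (E : LCtx) :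
    E.noLab ∨ ∃ (E₁ : LCtx) (ℓ : Nat) (E₂ : LCtx), E₂.noLab ∧ ∀ t, E.plug t = E₁.plug (.lab ℓ (E₂.plug t)) := by
  induction E with
  | hole => exact .inl trivial
  | appL E e ih =>
    rcases ih with hE | ⟨E₁, ℓ, E₂, hE₂, hE⟩
    · exact .inl hE
    · exact .inr ⟨.appL E₁ e, ℓ, E₂, hE₂, fun t => by rw [plug, plug, hE]⟩
  | labC j E ih =>
    rcases ih with hE | ⟨E₁, ℓ, E₂, hE₂, hE⟩
    · exact .inr ⟨.hole, j, E, hE, fun t => rfl⟩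
    · exact .inr ⟨.labC j E₁, ℓ, E₂, hE₂, fun t => by rw [plug, plug, hE]⟩

theorem lr_progress {h : Nat → LTm} {t : LTm} (ht : Coherent h 0 t) :
    LVal t ∨ ∃ t', LStep t t' := by
  rcases lval_or_redex ht with hv | ⟨E, f, e, b, rfl, hb⟩
  · exact .inl hv
  · obtain ⟨ℓ, hℓ⟩ := exists_fresh (E.plug (.app f e))
    rcases E.noLab_or_split with hE | ⟨E₁, j, E₂, hE₂, hE⟩
    · exact .inr ⟨_, .noLab E _ _ hE (.beta b e ℓ hb hℓ)⟩
    · rw [hE] at hℓ ⊢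
      exact .inr ⟨_, .underLab E₁ E₂ j _ _ hE₂ (.beta b e ℓ hb hℓ)⟩

theorem lr_value_of_ev (n : Nat) {h : Nat → LTm} {t : LTm} (ht : Coherent h 0 t)
    (he : Ev n t.erase []) : ∃ v, LVal v ∧ Relation.ReflTransGen LStep t v := by
  induction n using Nat.strong_induction_on generalizing h t with
  | _ n ih =>
    rcases lr_progress ht with hv | ⟨t', hs⟩
    · exact ⟨t, hv, .refl⟩
    · obtain ⟨⟨h', ht'⟩, -, hlt⟩ := hs.erase ht
      obtain ⟨m, hm, he⟩ := hlt n he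
      obtain ⟨v, hv, hr⟩ := ih m hm ht' he
      exact ⟨v, hv, .head hs hr⟩

theorem lr_value_iff_ev {h : Nat → LTm} {t : LTm} (ht : Coherent h 0 t) :
    (∃ v, LVal v ∧ Relation.ReflTransGen LStep t v) ↔ ∃ n, Ev n t.erase [] := by
  refine ⟨?_, fun ⟨n, he⟩ => lr_value_of_ev n ht he⟩
  rintro ⟨v, hv, hr⟩
  induction hr using Relation.ReflTransGen.head_induction_on generalizing h with
  | refl =>
    obtain ⟨b, hb⟩ := hv.wrapped
    rw [erase_wrapped hb]
    exact ⟨0, .lam _⟩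
  | head hs _ ih =>
    obtain ⟨⟨h', ht'⟩, hciu, -⟩ := hs.erase ht
    obtain ⟨n, hn⟩ := ih ht'
    obtain ⟨m, -, hm⟩ := hciu.ev hn
    exact ⟨m, hm⟩

theorem ClosedUnder.coherent_toL {k : Nat} {e : Tm} (he : ClosedUnder k e) (h : Nat → LTm) :
    Coherent h k (toL e) := by
  induction e generalizing k with
  | bvar i => exact he
  | lam b ih => exact ih he
  | app f a ihf iha => exact ⟨ihf he.1, iha he.2⟩

/-- for every closed pure λ-term, the standard reduction
    sequence of the revised call-by-need calculus reaches an answer iff the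
    λ_LR rewriting sequence reaches a value. -/
theorem need_lr_bisimulation (e : Tm) (he : ClosedUnder 0 e) :
    (∃ a, IsAnswer a ∧ Relation.ReflTransGen StdStep e a) ↔
    (∃ v, LVal v ∧ Relation.ReflTransGen LStep (toL e) v) := by
  rw [need_answer_iff_ev, lr_value_iff_ev (he.coherent_toL LTm.bvar), erase_toL]

end NeedCalc
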